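/- Let γ ∈ (0,1), Δ > 0, R > 0, and let (δ_k)_{k≥0} be a sequence of nonnegative real numbers with δ_0 ≤ R/(1−γ) and satisfying: (a) whenever δ_k > Δ/(1−γ), one has δ_{k+1} ≤ γ·δ_k − Δ; and (b) whenever δ_k ≤ Δ/(1−γ), one has δ_{k+1} ≤ γ·δ_k. Then for every ε with 0 < ε ≤ Δ/(1−γ), there exists k ≤ ⌈R/((1−γ)·Δ)⌉ + ⌈log(Δ/((1−γ)·ε))/log(1/γ)⌉ such that δ_k ≤ ε. -/

import Mathlib

/-- A real sequence that drops by at least `d` at every step where it exceeds `t ≥ 0` reaches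
`t` within `n` steps, as soon as its initial value is at most `n * d`. -/
lemma exists_le_of_linear_decrease {u : ℕ → ℝ} {d t : ℝ} {n : ℕ} (ht : 0 ≤ t)
    (hstep : ∀ k, t < u k → u (k + 1) ≤ u k - d) (h0 : u 0 ≤ n * d) :
    ∃ k ≤ n, u k ≤ t := by
  by_contra! h
  have key : ∀ k ≤ n, u k ≤ u 0 - k * d := by
    intro k
    induction k with
    | zero => simp
    | succ k ih =>
      intro hk
      have h1 := ih (by omega)
      have h2 := hstep k (h k (by omega))
      push_cast
      linarith
  linarith [key n le_rfl, h n le_rfl]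

/-- A real sequence contracting by the factor `c ∈ [0, 1]` at every step where it is at most
`t ≥ 0` decays geometrically from the moment it is at most `t`. -/
lemma le_pow_mul_of_contraction_below {u : ℕ → ℝ} {c t : ℝ} (hc0 : 0 ≤ c) (hc1 : c ≤ 1)
    (ht : 0 ≤ t) (hstep : ∀ k, u k ≤ t → u (k + 1) ≤ c * u k) {j : ℕ} (hj : u j ≤ t) (m : ℕ) :
    u (j + m) ≤ c ^ m * t := by
  induction m with
  | zero => simpa using hj
  | succ m ih =>
    have hle : u (j + m) ≤ t := ih.trans (mul_le_of_le_one_left ht (pow_le_one₀ hc0 hc1))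
    calc u (j + (m + 1)) ≤ c * u (j + m) := hstep _ hle
      _ ≤ c * (c ^ m * t) := mul_le_mul_of_nonneg_left ih hc0
      _ = c ^ (m + 1) * t := by ring

/-- The number of contractions by `c ∈ (0, 1)` needed to bring `t` down to `ε`. -/
lemma pow_ceil_log_div_log_mul_le {c t ε : ℝ} (hc0 : 0 < c) (hc1 : c < 1) (ht : 0 < t)
    (hε : 0 < ε) : c ^ ⌈Real.log (t / ε) / Real.log (1 / c)⌉₊ * t ≤ ε := by
  set m := ⌈Real.log (t / ε) / Real.log (1 / c)⌉₊
  have hlog : 0 < Real.log (1 / c) := Real.log_pos ((one_lt_div hc0).2 hc1)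
  have hm : Real.log (t / ε) ≤ m * Real.log (1 / c) := (div_le_iff₀ hlog).1 (Nat.le_ceil _)
  rw [← Real.log_pow, Real.log_le_log_iff (by positivity) (by positivity), one_div_pow,
    div_le_div_iff₀ hε (by positivity)] at hm
  linarith

theorem stmt10 (γ Δ R : ℝ) (hγ0 : 0 < γ) (hγ1 : γ < 1) (hΔ : 0 < Δ) (hR : 0 < R)
    (δ : ℕ → ℝ) (hnn : ∀ k, 0 ≤ δ k) (h0 : δ 0 ≤ R / (1 - γ))
    (hstepI : ∀ k, Δ / (1 - γ) < δ k → δ (k + 1) ≤ γ * δ k - Δ)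
    (hstepII : ∀ k, δ k ≤ Δ / (1 - γ) → δ (k + 1) ≤ γ * δ k) :
    ∀ ε : ℝ, 0 < ε → ε ≤ Δ / (1 - γ) →
      ∃ k : ℕ,
        k ≤ ⌈R / ((1 - γ) * Δ)⌉₊ + ⌈Real.log (Δ / ((1 - γ) * ε)) / Real.log (1 / γ)⌉₊ ∧
        δ k ≤ ε := by
  intro ε hε _
  have hγ : 0 < 1 - γ := sub_pos.2 hγ1
  have ht : 0 < Δ / (1 - γ) := div_pos hΔ hγ
  obtain ⟨j, hj, hjt⟩ := exists_le_of_linear_decrease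
    (n := ⌈R / ((1 - γ) * Δ)⌉₊) ht.le
    (fun k hk => (hstepI k hk).trans
      (sub_le_sub_right (mul_le_of_le_one_left (hnn k) hγ1.le) Δ))
    (h0.trans ((div_le_iff₀ hΔ).1 (by rw [div_div]; exact Nat.le_ceil _)))
  refine ⟨j + ⌈Real.log (Δ / ((1 - γ) * ε)) / Real.log (1 / γ)⌉₊, by gcongr, ?_⟩
  refine (le_pow_mul_of_contraction_below hγ0.le hγ1.le ht.le hstepII hjt _).trans ?_
  rw [← div_div]
  exact pow_ceil_log_div_log_mul_le hγ0 hγ1 ht hε
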